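/- Let n ≥ 1 and ε = cos(π/n) + i·sin(π/n) ∈ ℍ. The set {εᵏ : 0 ≤ k < 2n} ∪ {εᵏ·j : 0 ≤ k < 2n} is a subgroup of the group of unit quaternions; it has order 4n and is isomorphic to the generalized quaternion (dicyclic) group of order 4n, via an isomorphism carrying ε and j to the standard generators. -/

import Mathlib

noncomputable section

/-- The quaternion `ε = cos(π/n) + i·sin(π/n)`. -/
def epsQ (n : ℕ) : Quaternion ℝ :=
  ⟨Real.cos (Real.pi / n), Real.sin (Real.pi / n), 0, 0⟩

/-- The quaternion `j`. -/
def jQ : Quaternion ℝ := ⟨0, 0, 1, 0⟩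

/-- The group of unit quaternions `S³`. -/
abbrev UnitQuatSphere := Metric.sphere (0 : Quaternion ℝ) 1

section

open scoped Quaternion

/-- The unit quaternion `cos θ + i·sin θ`. -/
def cosAddSinI (θ : ℝ) : Quaternion ℝ := ⟨Real.cos θ, Real.sin θ, 0, 0⟩

@[simp] theorem re_cosAddSinI (θ : ℝ) : (cosAddSinI θ).re = Real.cos θ := rfl

@[simp] theorem imI_cosAddSinI (θ : ℝ) : (cosAddSinI θ).imI = Real.sin θ := rfl

@[simp] theorem imJ_cosAddSinI (θ : ℝ) : (cosAddSinI θ).imJ = 0 := rfl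

@[simp] theorem imK_cosAddSinI (θ : ℝ) : (cosAddSinI θ).imK = 0 := rfl

@[simp] theorem re_jQ : jQ.re = 0 := rfl

@[simp] theorem imI_jQ : jQ.imI = 0 := rfl

@[simp] theorem imJ_jQ : jQ.imJ = 1 := rfl

@[simp] theorem imK_jQ : jQ.imK = 0 := rfl

theorem epsQ_eq_cosAddSinI (n : ℕ) : epsQ n = cosAddSinI (Real.pi / n) := rfl

theorem cosAddSinI_add (θ η : ℝ) : cosAddSinI (θ + η) = cosAddSinI θ * cosAddSinI η := by
  apply Quaternion.ext <;> simp [Real.cos_add, Real.sin_add, add_comm]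

theorem epsQ_pow (n k : ℕ) : epsQ n ^ k = cosAddSinI (k * (Real.pi / n)) := by
  induction k with
  | zero => apply Quaternion.ext <;> simp
  | succ k ih =>
    rw [pow_succ, ih, epsQ_eq_cosAddSinI, ← cosAddSinI_add]
    congr 1
    push_cast
    ring

theorem epsQ_pow_self {n : ℕ} (hn : n ≠ 0) : epsQ n ^ n = -1 := by
  have h : (n : ℝ) * (Real.pi / n) = Real.pi := by field_simp
  rw [epsQ_pow, h]
  apply Quaternion.ext <;> simp

theorem epsQ_pow_eq_one {n k : ℕ} (hk : k < 2 * n) (h : epsQ n ^ k = 1) : k = 0 := by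
  have hn : (0 : ℝ) < n := by
    have : 0 < n := by omega
    exact_mod_cast this
  have hc : Real.cos (k * (Real.pi / n)) = 1 := by
    simpa [epsQ_pow] using congrArg QuaternionAlgebra.re h
  have hk' : (k : ℝ) < 2 * n := by exact_mod_cast hk
  have hlt : (k : ℝ) * (Real.pi / n) < 2 * Real.pi := by
    calc (k : ℝ) * (Real.pi / n) < 2 * n * (Real.pi / n) :=
          mul_lt_mul_of_pos_right hk' (by positivity)
      _ = 2 * Real.pi := by field_simp
  have h0 := (Real.cos_eq_one_iff_of_lt_of_lt
    (by have : 0 ≤ (k : ℝ) * (Real.pi / n) := by positivity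
        linarith [Real.pi_pos]) hlt).1 hc
  have : (k : ℝ) = 0 := by
    rcases mul_eq_zero.1 h0 with h | h
    · exact h
    · exact absurd h (by positivity)
  exact_mod_cast this

theorem jQ_mul_jQ : jQ * jQ = -1 := by
  apply Quaternion.ext <;> simp

theorem epsQ_mul_jQ_mul_epsQ (n : ℕ) : epsQ n * jQ * epsQ n = jQ := by
  apply Quaternion.ext <;> simp [epsQ_eq_cosAddSinI]
  · linarith [Real.sin_sq_add_cos_sq (Real.pi / n)]
  · ring

theorem jQ_mul_epsQ_pow_ne_one (n k : ℕ) : jQ * epsQ n ^ k ≠ 1 := fun h => by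
  simpa [epsQ_pow] using congrArg QuaternionAlgebra.re h

theorem norm_epsQ (n : ℕ) : ‖epsQ n‖ = 1 := by
  have h : Quaternion.normSq (epsQ n) = 1 := by
    simp [Quaternion.normSq_def', epsQ_eq_cosAddSinI]
  rw [Quaternion.normSq_eq_norm_mul_self] at h
  nlinarith [norm_nonneg (epsQ n)]

theorem norm_jQ : ‖jQ‖ = 1 := by
  have h : Quaternion.normSq jQ = 1 := by
    simp [Quaternion.normSq_def']
  rw [Quaternion.normSq_eq_norm_mul_self] at h
  nlinarith [norm_nonneg jQ]

end

/-- `epsQ n` as a unit quaternion. -/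
def epsSphere (n : ℕ) : UnitQuatSphere := ⟨epsQ n, by simp [norm_epsQ]⟩

/-- `jQ` as a unit quaternion. -/
def jSphere : UnitQuatSphere := ⟨jQ, by simp [norm_jQ]⟩

namespace QuaternionGroup

variable {G : Type*} [Group G] {n : ℕ}

/-- The homomorphism `k ↦ eᵏ` from `ZMod m`, for `e` with `eᵐ = 1`. -/
def zmodPow {m : ℕ} (e : G) (he : e ^ m = 1) : ZMod m →+ Additive G :=
  ZMod.lift m ⟨zmultiplesHom (Additive G) (Additive.ofMul e), by
    simp [← ofMul_pow, he]⟩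

theorem zmodPow_intCast {m : ℕ} (e : G) (he : e ^ m = 1) (k : ℤ) :
    (zmodPow e he k).toMul = e ^ k := by
  simp [zmodPow]

/-- The universal property of the generalized quaternion group. -/
def lift (e x : G) (he : e ^ (2 * n) = 1) (hx : x * x = e ^ n) (hex : e * x = x * e⁻¹) :
    QuaternionGroup n →* G :=
  have hcomm (k : ℤ) : e ^ k * x = x * e ^ (-k) := by
    have h : SemiconjBy x e⁻¹ e := hex.symm
    simpa using (h.zpow_right k).eq.symm
  MonoidHom.mk'
    (fun g => match g with
      | a i => (zmodPow e he i).toMul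
      | xa i => x * (zmodPow e he i).toMul)
    (by
      rintro (i | i) (j | j) <;>
        obtain ⟨i, rfl⟩ := ZMod.intCast_surjective i <;>
        obtain ⟨j, rfl⟩ := ZMod.intCast_surjective j
      · simp [zmodPow_intCast]
      · simp only [a_mul_xa, ← Int.cast_sub, zmodPow_intCast]
        rw [← mul_assoc, hcomm, mul_assoc, ← zpow_add, neg_add_eq_sub]
      · simp [zmodPow_intCast, mul_assoc]
      · simp only [xa_mul_xa, ← Int.cast_natCast (R := ZMod (2 * n)) n, ← Int.cast_sub,
          ← Int.cast_add, zmodPow_intCast]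
        rw [mul_assoc, ← mul_assoc (e ^ i), hcomm, mul_assoc, ← mul_assoc x x, hx,
          ← zpow_natCast, ← zpow_add, ← zpow_add]
        congr 1
        ring)

variable (e x : G) (he : e ^ (2 * n) = 1) (hx : x * x = e ^ n) (hex : e * x = x * e⁻¹)

theorem lift_a_intCast (k : ℤ) : lift e x he hx hex (a k) = e ^ k :=
  zmodPow_intCast e he k

theorem lift_xa_intCast (k : ℤ) : lift e x he hx hex (xa k) = x * e ^ k :=
  congrArg (x * ·) (zmodPow_intCast e he k)

theorem lift_a_natCast (k : ℕ) : lift e x he hx hex (a k) = e ^ k := by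
  simpa using lift_a_intCast e x he hx hex k

theorem lift_xa_natCast (k : ℕ) : lift e x he hx hex (xa k) = x * e ^ k := by
  simpa using lift_xa_intCast e x he hx hex k

theorem lift_xa_neg_natCast (k : ℕ) : lift e x he hx hex (xa (-k)) = e ^ k * x := by
  have h : (a k : QuaternionGroup n) * xa 0 = xa (-k) := by simp
  rw [← h, map_mul, lift_a_natCast]
  simpa using lift_xa_natCast e x he hx hex 0

end QuaternionGroup

/-- The embedding of the generalized quaternion group of order `4n` in the unit quaternions. -/
def quaternionGroupToSphere (n : ℕ) (hn : n ≠ 0) : QuaternionGroup n →* UnitQuatSphere :=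
  QuaternionGroup.lift (epsSphere n) jSphere
    (Subtype.ext <| by
      change epsQ n ^ (2 * n) = 1
      rw [mul_comm, pow_mul, epsQ_pow_self hn]; simp)
    (Subtype.ext <| by
      change jQ * jQ = epsQ n ^ n
      rw [epsQ_pow_self hn, jQ_mul_jQ])
    (eq_mul_inv_of_mul_eq <| Subtype.ext <| epsQ_mul_jQ_mul_epsQ n)

theorem coe_quaternionGroupToSphere_a {n : ℕ} (hn : n ≠ 0) (k : ℕ) :
    (quaternionGroupToSphere n hn (.a k) : Quaternion ℝ) = epsQ n ^ k :=
  congrArg Subtype.val (QuaternionGroup.lift_a_natCast (epsSphere n) jSphere _ _ _ k)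

theorem coe_quaternionGroupToSphere_xa {n : ℕ} (hn : n ≠ 0) (k : ℕ) :
    (quaternionGroupToSphere n hn (.xa k) : Quaternion ℝ) = jQ * epsQ n ^ k :=
  congrArg Subtype.val (QuaternionGroup.lift_xa_natCast (epsSphere n) jSphere _ _ _ k)

theorem coe_quaternionGroupToSphere_xa_neg {n : ℕ} (hn : n ≠ 0) (k : ℕ) :
    (quaternionGroupToSphere n hn (.xa (-k)) : Quaternion ℝ) = epsQ n ^ k * jQ :=
  congrArg Subtype.val (QuaternionGroup.lift_xa_neg_natCast (epsSphere n) jSphere _ _ _ k)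

theorem quaternionGroupToSphere_injective {n : ℕ} (hn : n ≠ 0) :
    Function.Injective (quaternionGroupToSphere n hn) := by
  have : NeZero n := ⟨hn⟩
  rw [injective_iff_map_eq_one]
  rintro (i | i) h <;> rw [← ZMod.natCast_zmod_val i] at h ⊢ <;>
    have h' := congrArg Subtype.val h
  · rw [coe_quaternionGroupToSphere_a] at h'
    rw [epsQ_pow_eq_one (ZMod.val_lt i) h']
    simp
  · rw [coe_quaternionGroupToSphere_xa] at h'
    exact absurd h' (jQ_mul_epsQ_pow_ne_one n _)

theorem coe_image_range_quaternionGroupToSphere {n : ℕ} (hn : n ≠ 0) :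
    (Set.image Subtype.val ((quaternionGroupToSphere n hn).range : Set UnitQuatSphere) :
      Set (Quaternion ℝ)) =
      {q | ∃ k : ℕ, k < 2 * n ∧ (q = epsQ n ^ k ∨ q = epsQ n ^ k * jQ)} := by
  have : NeZero n := ⟨hn⟩
  ext q
  constructor
  · rintro ⟨_, ⟨i | i, rfl⟩, rfl⟩
    · refine ⟨i.val, ZMod.val_lt i, Or.inl ?_⟩
      rw [← coe_quaternionGroupToSphere_a hn, ZMod.natCast_zmod_val]
    · refine ⟨(-i).val, ZMod.val_lt _, Or.inr ?_⟩
      rw [← coe_quaternionGroupToSphere_xa_neg hn, ZMod.natCast_zmod_val, neg_neg]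
  · rintro ⟨k, -, h | h⟩
    · exact ⟨_, ⟨.a k, rfl⟩, (coe_quaternionGroupToSphere_a hn k).trans h.symm⟩
    · exact ⟨_, ⟨.xa (-k), rfl⟩, (coe_quaternionGroupToSphere_xa_neg hn k).trans h.symm⟩

/-- The set `{εᵏ : 0 ≤ k < 2n} ∪ {εᵏ·j : 0 ≤ k < 2n}` is a subgroup of the
group of unit quaternions, of order `4n`, isomorphic to the generalized quaternion
(dicyclic) group of order `4n` via an isomorphism carrying the standard generators to `ε`
and `j`. -/
theorem unit_quaternion_subgroup_iso_quaternionGroup (n : ℕ) (hn : 1 ≤ n) :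
    ∃ Γ : Subgroup ↥UnitQuatSphere,
      (Γ : Set ↥UnitQuatSphere) =
        {q | ∃ k : ℕ, k < 2 * n ∧
          ((q : Quaternion ℝ) = epsQ n ^ k ∨ (q : Quaternion ℝ) = epsQ n ^ k * jQ)} ∧
      Nat.card Γ = 4 * n ∧
      ∃ φ : QuaternionGroup n ≃* Γ,
        (((φ (QuaternionGroup.a 1) : ↥UnitQuatSphere)) : Quaternion ℝ) = epsQ n ∧
        (((φ (QuaternionGroup.xa 0) : ↥UnitQuatSphere)) : Quaternion ℝ) = jQ := by
  have hn' : n ≠ 0 := by omega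
  have : NeZero n := ⟨hn'⟩
  let φ := MonoidHom.ofInjective (quaternionGroupToSphere_injective hn')
  refine ⟨(quaternionGroupToSphere n hn').range,
    coe_image_range_quaternionGroupToSphere hn', ?_, φ, ?_, ?_⟩
  · rw [← Nat.card_congr φ.toEquiv, Nat.card_eq_fintype_card, QuaternionGroup.card]
  · simpa [φ, MonoidHom.ofInjective_apply] using coe_quaternionGroupToSphere_a hn' 1
  · simpa [φ, MonoidHom.ofInjective_apply] using coe_quaternionGroupToSphere_xa hn' 0
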